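/- arXiv:2504.09576 — 5 statements merged into one kernel-verified Lean document; each statement's English description precedes it below -/
import Mathlib

section
/- Let Φ be a quantum channel on M_n(ℂ) and let D ∈ M_n(ℂ) be positive definite with Tr(D Φ(x)) = Tr(D x) for all x ∈ M_n(ℂ) (a faithful invariant state). Then the fixed point set M(Φ) = {x ∈ M_n(ℂ) : Φ(x) = x} is a unital *-subalgebra of M_n(ℂ): it contains the identity, is closed under linear combinations and adjoints, and whenever Φ(x) = x and Φ(y) = y one has Φ(x y) = x y. -/
open Matrix
open scoped ComplexOrder

noncomputable section

/-- `Mat n` is the algebra of complex `n × n` matrices. -/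
abbrev Mat (n : ℕ) : Type := Matrix (Fin n) (Fin n) ℂ

/-- Blockwise application of a linear map on `Mat n` to a `k × k` block matrix with
`n × n` blocks (i.e. the map `Φ ⊗ id_k`). -/
def blockMap (n k : ℕ) (Φ : Mat n →ₗ[ℂ] Mat n)
    (X : Matrix (Fin k × Fin n) (Fin k × Fin n) ℂ) :
    Matrix (Fin k × Fin n) (Fin k × Fin n) ℂ :=
  Matrix.of fun p q => Φ (Matrix.of fun i j => X (p.1, i) (q.1, j)) p.2 q.2

/-- A linear map on `Mat n` is completely positive if its blockwise application to any
positive semidefinite `k × k` block matrix is positive semidefinite. -/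
def IsCompletelyPositive (n : ℕ) (Φ : Mat n →ₗ[ℂ] Mat n) : Prop :=
  ∀ k : ℕ, 1 ≤ k → ∀ X : Matrix (Fin k × Fin n) (Fin k × Fin n) ℂ,
    X.PosSemidef → (blockMap n k Φ X).PosSemidef

/-- A quantum channel is a unital completely positive linear map. -/
def IsQuantumChannel (n : ℕ) (Φ : Mat n →ₗ[ℂ] Mat n) : Prop :=
  IsCompletelyPositive n Φ ∧ Φ 1 = 1

lemma block_psd {n : ℕ} (Φ : Mat n →ₗ[ℂ] Mat n) (hΦ : IsQuantumChannel n Φ) (x : Mat n) :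
    (fromBlocks 1 (Φ x) (Φ xᴴ) (Φ (xᴴ * x))).PosSemidef := by
  let V : Matrix (Fin n) (Fin 2 × Fin n) ℂ :=
    Matrix.of fun i p => (![(1 : Mat n), x] p.1) i p.2
  have h := hΦ.1 2 (by norm_num) (Vᴴ * V) (posSemidef_conjTranspose_mul_self V)
  have hb : ∀ a b : Fin 2, (Matrix.of fun i j => (Vᴴ * V) (a, i) (b, j)) =
      (![(1 : Mat n), x] a)ᴴ * (![(1 : Mat n), x] b) := by
    intro a b
    ext i j
    simp [V, Matrix.mul_apply]
  have h2 := h.submatrix (Sum.elim (fun i => ((0 : Fin 2), i)) (fun i => ((1 : Fin 2), i)) :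
    Fin n ⊕ Fin n → Fin 2 × Fin n)
  convert h2 using 1
  ext (i | i) (j | j) <;> simp [blockMap, hb, hΦ.2]

lemma map_star {n : ℕ} (Φ : Mat n →ₗ[ℂ] Mat n) (hΦ : IsQuantumChannel n Φ) (x : Mat n) :
    Φ xᴴ = (Φ x)ᴴ := by
  have h := (block_psd Φ hΦ x).isHermitian
  rw [isHermitian_fromBlocks_iff] at h
  exact h.2.1.symm

lemma schwarz {n : ℕ} (Φ : Mat n →ₗ[ℂ] Mat n) (hΦ : IsQuantumChannel n Φ) (x : Mat n) :
    (Φ (xᴴ * x) - (Φ x)ᴴ * Φ x).PosSemidef := by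
  have h := block_psd Φ hΦ x
  rw [map_star Φ hΦ x] at h
  haveI : Invertible (1 : Mat n) := invertibleOne
  have := (PosDef.fromBlocks₁₁ (Φ x) (Φ (xᴴ * x)) (PosDef.one (n := Fin n) (R := ℂ))).1 h
  simpa using this

lemma faithful {n : ℕ} (D P : Mat n) (hD : D.PosDef) (hP : P.PosSemidef)
    (h : (D * P).trace = 0) : P = 0 := by
  obtain ⟨B, rfl⟩ : ∃ B : Mat n, P = Bᴴ * B := by
    open scoped MatrixOrder Matrix.Norms.L2Operator in
    exact CStarAlgebra.nonneg_iff_eq_star_mul_self.mp hP.nonneg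
  have h1 : (B * D * Bᴴ).trace = 0 := by
    rw [← h, ← Matrix.mul_assoc, Matrix.trace_mul_comm (D * Bᴴ) B, Matrix.mul_assoc]
  have h2 : B * D * Bᴴ = 0 :=
    (hD.posSemidef.mul_mul_conjTranspose_same B).trace_eq_zero_iff.1 h1
  have h3 : B = 0 := by
    ext i j
    by_contra hne
    have hu : star (B i) ≠ 0 := by
      intro h0
      apply hne
      have := congrFun h0 j
      simpa using this
    have := hD.dotProduct_mulVec_pos hu
    have h4 := congrFun (congrFun h2 i) i
    rw [Matrix.mul_assoc] at h4
    have : (B * (D * Bᴴ)) i i = star (star (B i)) ⬝ᵥ D *ᵥ star (B i) := by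
      simp [Matrix.mul_apply, dotProduct, mulVec]
    rw [h4] at this
    simp_all
  simp [h3]

lemma fixed_sq {n : ℕ} (Φ : Mat n →ₗ[ℂ] Mat n)
    (hΦ : IsQuantumChannel n Φ) (D : Mat n) (hD : D.PosDef)
    (hinv : ∀ x : Mat n, (D * Φ x).trace = (D * x).trace) (x : Mat n) (hx : Φ x = x) :
    Φ (xᴴ * x) = xᴴ * x := by
  have h := schwarz Φ hΦ x
  rw [hx] at h
  refine sub_eq_zero.1 (faithful D _ hD h ?_)
  rw [Matrix.mul_sub, Matrix.trace_sub, hinv, sub_self]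

/-- **The fixed point set of a quantum channel with a faithful invariant state is a
unital *-subalgebra.** -/
theorem fixedPoints_subalgebra {n : ℕ} (Φ : Mat n →ₗ[ℂ] Mat n)
    (hΦ : IsQuantumChannel n Φ) (D : Mat n) (hD : D.PosDef)
    (hinv : ∀ x : Mat n, (D * Φ x).trace = (D * x).trace) :
    Φ 1 = 1 ∧
    (∀ (x y : Mat n) (a b : ℂ), Φ x = x → Φ y = y →
      Φ (a • x + b • y) = a • x + b • y) ∧
    (∀ x : Mat n, Φ x = x → Φ xᴴ = xᴴ) ∧
    (∀ x y : Mat n, Φ x = x → Φ y = y → Φ (x * y) = x * y) := by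
  have hlin : ∀ (x y : Mat n) (a b : ℂ), Φ x = x → Φ y = y →
      Φ (a • x + b • y) = a • x + b • y := by
    intro x y a b hx hy
    rw [map_add, map_smul, map_smul, hx, hy]
  have hst : ∀ x : Mat n, Φ x = x → Φ xᴴ = xᴴ := by
    intro x hx
    rw [map_star Φ hΦ, hx]
  refine ⟨hΦ.2, hlin, hst, ?_⟩
  intro x y hx hy
  have hsq := fixed_sq Φ hΦ D hD hinv
  have hx' := hst x hx
  have q0 := hsq xᴴ hx'
  have q1 := hsq y hy
  have q2 := hsq (xᴴ + y) (by rw [map_add, hx', hy])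
  have q3 := hsq (xᴴ + Complex.I • y) (by rw [map_add, map_smul, hx', hy])
  have e : x * y = (1 / 2 : ℂ) • ((xᴴ + y)ᴴ * (xᴴ + y)
      + (-Complex.I) • ((xᴴ + Complex.I • y)ᴴ * (xᴴ + Complex.I • y)))
      + (-(1 - Complex.I) / 2) • (xᴴᴴ * xᴴ + yᴴ * y) := by
    simp only [conjTranspose_add, conjTranspose_smul, conjTranspose_conjTranspose,
      Matrix.add_mul, Matrix.mul_add, Matrix.smul_mul, Matrix.mul_smul, smul_add, smul_smul]
    have hI : star Complex.I = -Complex.I := by simp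
    rw [hI]
    match_scalars <;> ring_nf <;> simp <;> ring
  rw [e]
  simp only [map_add, map_smul] at q0 q1 q2 q3 ⊢
  simp only [q0, q1, q2, q3, map_add, map_smul]
end
end

section
/- Let Φ be a quantum channel on M_n(ℂ) and let D ∈ M_n(ℂ) be positive definite such that Φ satisfies the detailed balance condition with respect to the faithful state ρ(x) = Tr(D x), i.e. Tr(D Φ(y)* x) = Tr(D y* Φ(x)) for all x, y ∈ M_n(ℂ). Then Φ commutes with the modular automorphism of ρ: Φ(D x D^{-1}) = D Φ(x) D^{-1} for all x ∈ M_n(ℂ). -/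
open Matrix
open scoped ComplexOrder

noncomputable section

theorem phi_conjTranspose_aux {n : ℕ} (Φ : Mat n →ₗ[ℂ] Mat n)
    (hΦ : IsCompletelyPositive n Φ) (A : Mat n) : Φ Aᴴ = (Φ A)ᴴ := by
  let C : Fin 2 → Mat n := ![A, 1]
  let B : Matrix (Fin 2 × Fin n) (Fin n) ℂ := Matrix.of fun p j => C p.1 p.2 j
  have hB : (B * Bᴴ).PosSemidef := Matrix.posSemidef_self_mul_conjTranspose B
  have h := (hΦ 2 (by norm_num) _ hB).isHermitian
  have hblk : ∀ a b : Fin 2,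
      (Matrix.of fun i j => (B * Bᴴ) (a, i) (b, j) : Mat n) = C a * (C b)ᴴ := by
    intro a b
    ext i j
    simp [B, Matrix.mul_apply]
  have e01 : C 0 * (C 1)ᴴ = A := by simp [C]
  have e10 : C 1 * (C 0)ᴴ = Aᴴ := by simp [C]
  ext i j
  have h2 := h.apply (1, i) (0, j)
  simp only [blockMap, Matrix.of_apply] at h2
  rw [hblk, hblk, e01, e10] at h2
  rw [Matrix.conjTranspose_apply]
  exact h2.symm

/-- **GNS symmetry implies commutation with the modular automorphism.**
If a quantum channel `Φ` satisfies the detailed balance condition with respect to the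
faithful state `ρ(x) = Tr(D x)`, then `Φ(D x D⁻¹) = D Φ(x) D⁻¹` for all `x`. -/
theorem detailedBalance_commutes_modular {n : ℕ} (Φ : Mat n →ₗ[ℂ] Mat n)
    (hΦ : IsQuantumChannel n Φ) (D : Mat n) (hD : D.PosDef)
    (hdb : ∀ x y : Mat n, (D * (Φ y)ᴴ * x).trace = (D * yᴴ * Φ x).trace) :
    ∀ x : Mat n, Φ (D * x * D⁻¹) = D * Φ x * D⁻¹ := by
  intro x
  have hu : IsUnit D.det := (Matrix.isUnit_iff_isUnit_det D).1 hD.isUnit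
  have key : ∀ a b : Mat n, (D * Φ a * b).trace = (D * a * Φ b).trace := by
    intro a b
    have := hdb b aᴴ
    rwa [phi_conjTranspose_aux Φ hΦ.1, conjTranspose_conjTranspose,
      conjTranspose_conjTranspose] at this
  have hz : D * x * D⁻¹ * D = D * x := Matrix.nonsing_inv_mul_cancel_right _ _ hu
  have main : D * Φ x = Φ (D * x * D⁻¹) * D := by
    generalize D * x * D⁻¹ = z at hz ⊢
    apply Matrix.ext_iff_trace_mul_right.2
    intro a
    rw [key, ← hz, Matrix.mul_assoc, Matrix.trace_mul_comm, key, Matrix.trace_mul_comm,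
      ← Matrix.mul_assoc]
  rw [main, Matrix.mul_nonsing_inv_cancel_right _ _ hu]
end
end

section
/- Let Φ be a quantum channel on M_n(ℂ). Then the Cesàro means (1/ℓ) Σ_{k=1}^{ℓ} Φ^k converge, as ℓ → ∞, to a linear map E_Φ on M_n(ℂ) which is itself a quantum channel and satisfies E_Φ ∘ E_Φ = E_Φ, Φ ∘ E_Φ = E_Φ ∘ Φ = E_Φ, and whose range equals the fixed point space {x ∈ M_n(ℂ) : Φ(x) = x}. -/
open Matrix
open scoped ComplexOrder

noncomputable section

open Filter

section Helpers

theorem aux_ergodic {V : Type*} [NormedAddCommGroup V] [NormedSpace ℂ V] [FiniteDimensional ℂ V]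
    (f : V →ₗ[ℂ] V) (hb : ∀ x, ∃ C : ℝ, ∀ k : ℕ, ‖(f ^ k) x‖ ≤ C) :
    ∃ E : V →ₗ[ℂ] V,
      (∀ x : V, Tendsto
        (fun l : ℕ => (l : ℂ)⁻¹ • ∑ k ∈ Finset.Icc 1 l, (f ^ k) x)
        atTop (nhds (E x))) ∧ (∀ x, f (E x) = E x) ∧ (∀ x, E (f x) = E x) ∧
        (∀ x, f x = x → E x = x) := by
  have hfix : ∀ x, f x = x → ∀ k : ℕ, (f ^ k) x = x := by
    intro x hx k
    induction k with
    | zero => simp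
    | succ k ih => rw [pow_succ, Module.End.mul_apply, hx, ih]
  have hdisj : Disjoint (LinearMap.ker (f - 1)) (LinearMap.range (f - 1)) := by
    rw [Submodule.disjoint_def]
    rintro z hz ⟨y, hy⟩
    have hz' : f z = z := by
      simpa [sub_eq_zero] using hz
    have hy' : f y = y + z := by
      rw [← hy]; simp
    have hk : ∀ k : ℕ, (f ^ k) y = y + (k : ℂ) • z := by
      intro k
      induction k with
      | zero => simp
      | succ k ih =>
        rw [pow_succ, Module.End.mul_apply, hy', map_add, ih, hfix z hz']
        push_cast
        module
    obtain ⟨C, hC⟩ := hb y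
    by_contra hne
    have hpos : 0 < ‖z‖ := norm_pos_iff.mpr hne
    obtain ⟨k, hk'⟩ := exists_nat_gt ((C + ‖y‖) / ‖z‖)
    rw [div_lt_iff₀ hpos] at hk'
    have h1 := hC k
    have h2 : (k : ℂ) • z = (f ^ k) y - y := by rw [hk]; simp
    have h3 : (k : ℝ) * ‖z‖ ≤ ‖(f ^ k) y‖ + ‖y‖ := by
      have := norm_sub_le ((f ^ k) y) y
      rw [← h2, norm_smul] at this
      simpa using this
    linarith
  have hc : IsCompl (LinearMap.ker (f - 1)) (LinearMap.range (f - 1)) := by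
    rw [Submodule.isCompl_iff_disjoint]
    · exact hdisj
    · rw [add_comm, LinearMap.finrank_range_add_finrank_ker]
  refine ⟨Submodule.projection _ _ hc, ?_, ?_, ?_, ?_⟩
  · intro x
    obtain ⟨b, hb'⟩ := Submodule.sub_projection_mem hc x
    have ha := Submodule.projection_apply_mem hc x
    set a := Submodule.projection _ _ hc x with ha_def
    have ha' : f a = a := by
      simpa [sub_eq_zero] using ha
    have hx : x = a + (f b - b) := by
      have : f b - b = x - a := by simpa using hb'
      rw [this]; abel
    have hsum : ∀ l : ℕ, ∑ k ∈ Finset.Icc 1 l, (f ^ k) x = (l : ℂ) • a + ((f ^ (l + 1)) b - f b) := by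
      intro l
      induction l with
      | zero => simp
      | succ l ih =>
        rw [Finset.sum_Icc_succ_top (by omega), ih, hx, map_add, hfix a ha', map_sub,
          pow_succ f (l + 1), Module.End.mul_apply]
        push_cast
        module
    obtain ⟨C, hC⟩ := hb b
    have hlim : Tendsto (fun l : ℕ => (l : ℂ)⁻¹ • ((f ^ (l + 1)) b - f b)) atTop (nhds 0) := by
      have h0 : Tendsto (fun l : ℕ => (l : ℝ)⁻¹ * (C + ‖f b‖)) atTop (nhds 0) := by
        simpa using (tendsto_inv_atTop_nhds_zero_nat (𝕜 := ℝ)).mul_const (C + ‖f b‖)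
      refine squeeze_zero_norm (fun l => ?_) h0
      rw [norm_smul, norm_inv, Complex.norm_natCast]
      gcongr
      exact (norm_sub_le _ _).trans (by gcongr; exact hC _)
    have := hlim.const_add a
    rw [add_zero] at this
    refine this.congr' ?_
    filter_upwards [eventually_gt_atTop 0] with l hl
    have : (l : ℂ) ≠ 0 := by exact_mod_cast hl.ne'
    rw [hsum, smul_add, smul_smul, inv_mul_cancel₀ this, one_smul]
  · intro x
    have := LinearMap.mem_ker.mp (Submodule.projection_apply_mem hc x)
    rw [LinearMap.sub_apply, sub_eq_zero] at this
    exact this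
  · intro x
    rw [← sub_eq_zero, ← map_sub, Submodule.projection_apply_eq_zero_iff]
    exact ⟨x, by simp⟩
  · intro x hx
    apply Submodule.projection_apply_of_mem_left
    simp [hx]

theorem blockMap_pow_psd {n : ℕ} (Φ : Mat n →ₗ[ℂ] Mat n) (h : IsCompletelyPositive n Φ) (m : ℕ) :
    IsCompletelyPositive n (Φ ^ m) := by
  induction m with
  | zero =>
    intro k hk X hX
    exact hX
  | succ m ih =>
    intro k hk X hX
    rw [pow_succ]
    exact ih k hk _ (h k hk X hX)

theorem cp_pos {n : ℕ} (Φ : Mat n →ₗ[ℂ] Mat n) (h : IsCompletelyPositive n Φ) (A : Mat n)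
    (hA : A.PosSemidef) : (Φ A).PosSemidef :=
  (h 1 le_rfl (A.submatrix Prod.snd Prod.snd) (hA.submatrix _)).submatrix
    (fun i : Fin n => ((0 : Fin 1), i))

open scoped MatrixOrder Matrix.Norms.L2Operator

theorem channel_bdd {n : ℕ} (Φ : Mat n →ₗ[ℂ] Mat n) (h : IsQuantumChannel n Φ) (x : Mat n) :
    ∃ C : ℝ, ∀ k : ℕ, ‖(Φ ^ k) x‖ ≤ C := by
  have hx : x ∈ Submodule.span ℂ {a : Mat n | 0 ≤ a} := by
    rw [CStarAlgebra.span_nonneg]; trivial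
  have h1 : ∀ k : ℕ, (Φ ^ k) 1 = 1 := by
    intro k
    induction k with
    | zero => simp
    | succ k ih => rw [pow_succ, Module.End.mul_apply, h.2, ih]
  induction hx using Submodule.span_induction with
  | mem a ha =>
    have ha : 0 ≤ a := ha
    refine ⟨‖a‖, fun k => ?_⟩
    have hpos : ∀ b : Mat n, 0 ≤ b → 0 ≤ (Φ ^ k) b := fun b hb =>
      (cp_pos _ (blockMap_pow_psd Φ h.1 k) b hb.posSemidef).nonneg
    rw [CStarAlgebra.norm_le_iff_le_algebraMap _ (norm_nonneg _) (hpos a ha)]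
    have h2 : a ≤ algebraMap ℝ (Mat n) ‖a‖ := (IsSelfAdjoint.of_nonneg ha).le_algebraMap_norm_self
    have h3 := hpos _ (sub_nonneg.mpr h2)
    rw [map_sub, sub_nonneg] at h3
    refine h3.trans (le_of_eq ?_)
    have : algebraMap ℝ (Mat n) ‖a‖ = ((‖a‖ : ℝ) : ℂ) • (1 : Mat n) := by
      rw [Algebra.algebraMap_eq_smul_one]; rfl
    rw [this, map_smul, h1]
  | zero => exact ⟨0, fun k => by simp⟩
  | add a b _ _ iha ihb =>
    obtain ⟨C, hC⟩ := iha
    obtain ⟨D, hD⟩ := ihb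
    refine ⟨C + D, fun k => ?_⟩
    rw [map_add]
    exact (norm_add_le _ _).trans (add_le_add (hC k) (hD k))
  | smul c a _ iha =>
    obtain ⟨C, hC⟩ := iha
    refine ⟨‖c‖ * C, fun k => ?_⟩
    rw [map_smul, norm_smul]
    gcongr
    exact hC k

theorem channel_ergodic {n : ℕ} (Φ : Mat n →ₗ[ℂ] Mat n) (h : IsQuantumChannel n Φ) :
    ∃ E : Mat n →ₗ[ℂ] Mat n,
      (∀ x : Mat n, Tendsto
        (fun l : ℕ => (l : ℂ)⁻¹ • ∑ k ∈ Finset.Icc 1 l, (Φ ^ k) x)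
        atTop (nhds (E x))) ∧ (∀ x, Φ (E x) = E x) ∧ (∀ x, E (Φ x) = E x) ∧
        (∀ x, Φ x = x → E x = x) :=
  aux_ergodic Φ (channel_bdd Φ h)

theorem psd_closed {ι : Type*} [Fintype ι] [DecidableEq ι] :
    IsClosed {A : Matrix ι ι ℂ | A.PosSemidef} := by
  have := CStarAlgebra.isClosed_nonneg (A := Matrix ι ι ℂ)
  simpa only [Matrix.nonneg_iff_posSemidef] using this

end Helpers

theorem psd_closed' {ι : Type*} [Fintype ι] [DecidableEq ι] :
    IsClosed {A : Matrix ι ι ℂ | A.PosSemidef} := psd_closed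

theorem channel_ergodic' {n : ℕ} (Φ : Mat n →ₗ[ℂ] Mat n) (h : IsQuantumChannel n Φ) :
    ∃ E : Mat n →ₗ[ℂ] Mat n,
      (∀ x : Mat n, Tendsto
        (fun l : ℕ => (l : ℂ)⁻¹ • ∑ k ∈ Finset.Icc 1 l, (Φ ^ k) x)
        atTop (nhds (E x))) ∧ (∀ x, Φ (E x) = E x) ∧ (∀ x, E (Φ x) = E x) ∧
        (∀ x, Φ x = x → E x = x) := channel_ergodic Φ h

/-- **Convergence of Cesàro means of a quantum channel.** The means
`(1/ℓ) Σ_{k=1}^{ℓ} Φ^k` converge to an idempotent quantum channel `E_Φ` commuting with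
`Φ`, whose range is the fixed point space of `Φ`. -/
theorem cesaro_mean_channel {n : ℕ} (Φ : Mat n →ₗ[ℂ] Mat n)
    (hΦ : IsQuantumChannel n Φ) :
    ∃ E : Mat n →ₗ[ℂ] Mat n,
      (∀ x : Mat n, Tendsto
        (fun ℓ : ℕ => (ℓ : ℂ)⁻¹ • ∑ k ∈ Finset.Icc 1 ℓ, (Φ ^ k) x)
        atTop (nhds (E x))) ∧
      IsQuantumChannel n E ∧
      E.comp E = E ∧
      Φ.comp E = E ∧
      E.comp Φ = E ∧
      Set.range E = {x : Mat n | Φ x = x} := by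
  obtain ⟨E, hlim, h1, h2, h3⟩ := channel_ergodic' Φ hΦ
  refine ⟨E, hlim, ⟨?_, h3 1 hΦ.2⟩, ?_, ?_, ?_, ?_⟩
  · intro k hk X hX
    have ht : Tendsto (fun l : ℕ => (l : ℂ)⁻¹ • ∑ m ∈ Finset.Icc 1 l, blockMap n k (Φ ^ m) X)
        atTop (nhds (blockMap n k E X)) := by
      refine tendsto_pi_nhds.mpr fun p => tendsto_pi_nhds.mpr fun q => ?_
      have := tendsto_pi_nhds.mp (tendsto_pi_nhds.mp
        (hlim (Matrix.of fun i j => X (p.1, i) (q.1, j))) p.2) q.2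
      refine this.congr fun l => ?_
      simp [Matrix.sum_apply, blockMap]
    refine psd_closed'.mem_of_tendsto ht (Eventually.of_forall fun l => ?_)
    refine Matrix.PosSemidef.smul ?_ ?_
    · exact Matrix.posSemidef_sum _ fun m _ => blockMap_pow_psd Φ hΦ.1 m k hk X hX
    · rw [← Complex.ofReal_natCast, ← Complex.ofReal_inv]
      exact Complex.zero_le_real.mpr (by positivity)
  · ext1 x
    exact h3 _ (h1 x)
  · ext1 x
    exact h1 x
  · ext1 x
    exact h2 x
  · ext x
    constructor
    · rintro ⟨y, rfl⟩
      exact h1 y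
    · intro hx
      exact ⟨x, h3 x hx⟩
end
end

section
/- Let (Φ_t)_{t≥0} be a quantum Markov semigroup on M_n(ℂ) such that for every t ≥ 0 there exists a positive definite D_t ∈ M_n(ℂ) with Tr(D_t) = 1 and Tr(D_t Φ_t(x)) = Tr(D_t x) for all x (each Φ_t admits a faithful invariant state). Assume the Cesàro means (1/T) ∫_0^T Φ_s ds converge as T → ∞ to a linear map E on M_n(ℂ). Then the fixed point space M = {x ∈ M_n(ℂ) : Φ_t(x) = x for all t ≥ 0} equals the multiplicative domain N = {x ∈ M_n(ℂ) : Φ_t(x* x) = Φ_t(x)* Φ_t(x) and Φ_t(x x*) = Φ_t(x) Φ_t(x)* for all t ≥ 0} if and only if Φ_t(x) converges to E(x) as t → ∞ for every x ∈ M_n(ℂ). -/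
open Matrix
open scoped ComplexOrder

noncomputable section

/-- A quantum Markov semigroup on `Mat n`. -/
def IsQMS (n : ℕ) (Φ : ℝ → (Mat n →ₗ[ℂ] Mat n)) : Prop :=
  (∀ t : ℝ, 0 ≤ t → IsQuantumChannel n (Φ t)) ∧
  Φ 0 = LinearMap.id ∧
  (∀ s t : ℝ, 0 ≤ s → 0 ≤ t → Φ (s + t) = (Φ s).comp (Φ t)) ∧
  (∀ x : Mat n, Continuous fun t : ℝ => Φ t x)

open Filter

open scoped MatrixOrder Matrix.Norms.L2Operator in
lemma qms_factor {n : ℕ} {p : Mat n} (hp : p.PosSemidef) : ∃ x : Mat n, p = xᴴ * x :=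
  CStarAlgebra.nonneg_iff_eq_star_mul_self.mp (Matrix.nonneg_iff_posSemidef.mpr hp)

lemma qms_schwarz {n : ℕ} {Φ : Mat n →ₗ[ℂ] Mat n} (h : IsQuantumChannel n Φ) (x : Mat n) :
    Φ xᴴ = (Φ x)ᴴ ∧ (Φ (xᴴ * x) - (Φ x)ᴴ * Φ x).PosSemidef := by
  obtain ⟨hcp, h1⟩ := h
  let R : Matrix (Fin n) (Fin 2 × Fin n) ℂ :=
    Matrix.of fun i p => if p.1 = 0 then (1 : Mat n) i p.2 else x i p.2
  have hX := hcp 2 (by norm_num) (Rᴴ * R) (Matrix.posSemidef_conjTranspose_mul_self R)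
  set Y := blockMap n 2 Φ (Rᴴ * R) with hY
  have e00 : ∀ i j, Y (0, i) (0, j) = (1 : Mat n) i j := by
    intro i j
    have : (Matrix.of fun i j => (Rᴴ * R) ((0 : Fin 2), i) ((0 : Fin 2), j)) = (1 : Mat n)ᴴ * 1 := by
      ext i j; simp only [R, Matrix.of_apply, Matrix.mul_apply, Matrix.conjTranspose_apply]; simp
    simp only [hY, blockMap, Matrix.of_apply]
    rw [this]; simp [h1]
  have e01 : ∀ i j, Y (0, i) (1, j) = Φ x i j := by
    intro i j
    have : (Matrix.of fun i j => (Rᴴ * R) ((0 : Fin 2), i) ((1 : Fin 2), j)) = (1 : Mat n)ᴴ * x := by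
      ext i j; simp only [R, Matrix.of_apply, Matrix.mul_apply, Matrix.conjTranspose_apply]; simp
    simp only [hY, blockMap, Matrix.of_apply]
    rw [this]; simp
  have e10 : ∀ i j, Y (1, i) (0, j) = Φ xᴴ i j := by
    intro i j
    have : (Matrix.of fun i j => (Rᴴ * R) ((1 : Fin 2), i) ((0 : Fin 2), j)) = xᴴ * 1 := by
      ext i j; simp only [R, Matrix.of_apply, Matrix.mul_apply, Matrix.conjTranspose_apply]; simp
    simp only [hY, blockMap, Matrix.of_apply]
    rw [this]; simp
  have e11 : ∀ i j, Y (1, i) (1, j) = Φ (xᴴ * x) i j := by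
    intro i j
    have : (Matrix.of fun i j => (Rᴴ * R) ((1 : Fin 2), i) ((1 : Fin 2), j)) = xᴴ * x := by
      ext i j; simp only [R, Matrix.of_apply, Matrix.mul_apply, Matrix.conjTranspose_apply]; simp
    simp only [hY, blockMap, Matrix.of_apply]
    rw [this]
  have hs : Φ xᴴ = (Φ x)ᴴ := by
    ext i j
    rw [← e10, Matrix.conjTranspose_apply, ← e01, hX.1.apply]
  refine ⟨hs, ?_⟩
  let B : Matrix (Fin 2 × Fin n) (Fin n) ℂ :=
    Matrix.of fun p j => if p.1 = 0 then - (Φ x) p.2 j else (1 : Mat n) p.2 j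
  have hB := hX.conjTranspose_mul_mul_same B
  convert hB using 1
  have hYB : Y * B = Matrix.of fun p j => if p.1 = 0 then 0 else
      (Φ (xᴴ * x) - (Φ x)ᴴ * Φ x) p.2 j := by
    ext ⟨p, i⟩ j
    rw [Matrix.mul_apply, Fintype.sum_prod_type]
    fin_cases p
    · simp [B, e00, e01, Matrix.one_apply]
    · simp [B, e10, e11, hs, Matrix.one_apply, Matrix.mul_apply]; ring
  rw [Matrix.mul_assoc, hYB]
  ext i j
  rw [Matrix.mul_apply, Fintype.sum_prod_type]
  rw [Fin.sum_univ_two]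
  simp only [Matrix.of_apply, if_true, mul_zero, Finset.sum_const_zero, zero_add,
    if_neg (show (1 : Fin 2) ≠ 0 by decide), B, Matrix.conjTranspose_apply]
  rw [Finset.sum_eq_single i]
  · simp
  · intro b _ hb; simp [Matrix.one_apply, hb]
  · simp

lemma qms_pos {n : ℕ} {Φ : Mat n →ₗ[ℂ] Mat n} (h : IsQuantumChannel n Φ) {p : Mat n}
    (hp : p.PosSemidef) : (Φ p).PosSemidef := by
  obtain ⟨x, rfl⟩ : ∃ x, p = xᴴ * x := qms_factor hp
  have := (qms_schwarz h x).2.add (Matrix.posSemidef_conjTranspose_mul_self (Φ x))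
  simpa using this

lemma qms_trace_nonneg {n : ℕ} {D p : Mat n} (hD : D.PosDef) (hp : p.PosSemidef) :
    0 ≤ ((D * p).trace).re ∧ (((D * p).trace).re = 0 → p = 0) := by
  obtain ⟨x, rfl⟩ : ∃ x, p = x * xᴴ := by
    obtain ⟨x, hx⟩ := qms_factor hp
    exact ⟨xᴴ, by simpa using hx⟩
  have e : (D * (x * xᴴ)).trace = ∑ j, star (x.col j) ⬝ᵥ (D *ᵥ (x.col j)) := by
    rw [← Matrix.mul_assoc, Matrix.trace_mul_comm, ← Matrix.mul_assoc, Matrix.mul_assoc]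
    rfl
  have nn : ∀ j, 0 ≤ (star (x.col j) ⬝ᵥ (D *ᵥ (x.col j))).re := fun j =>
    (Complex.le_def.mp (hD.posSemidef.dotProduct_mulVec_nonneg _)).1
  rw [e, Complex.re_sum]
  refine ⟨Finset.sum_nonneg fun j _ => nn j, fun h0 => ?_⟩
  rw [Finset.sum_eq_zero_iff_of_nonneg fun j _ => nn j] at h0
  have : x = 0 := by
    ext i j
    by_contra hne
    have hc : x.col j ≠ 0 := fun h => hne (by simpa using congrFun h i)
    have := (Complex.lt_def.mp (hD.dotProduct_mulVec_pos hc)).1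
    rw [h0 j (Finset.mem_univ _)] at this
    simp at this
  simp [this]

/-- a common faithful invariant positive functional -/
lemma qms_state {n : ℕ} (Φ : ℝ → (Mat n →ₗ[ℂ] Mat n))
    (hΦ : IsQMS n Φ)
    (hinv : ∀ t : ℝ, 0 ≤ t → ∃ D : Mat n, D.PosDef ∧ D.trace = 1 ∧
      ∀ x : Mat n, (D * Φ t x).trace = (D * x).trace) :
    ∃ ω : Mat n →ₗ[ℝ] ℝ, (∀ p : Mat n, p.PosSemidef → 0 ≤ ω p) ∧
      (∀ p : Mat n, p.PosSemidef → ω p = 0 → p = 0) ∧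
      (∀ t, 0 ≤ t → ∀ x, ω (Φ t x) = ω x) := by
  obtain ⟨hch, h0, hadd, hcont⟩ := hΦ
  obtain ⟨D, hD, -, hDi⟩ := hinv 1 zero_le_one
  have hc : ∀ x, Continuous fun s : ℝ => ((D * Φ s x).trace).re := fun x =>
    Complex.continuous_re.comp ((continuous_const.matrix_mul (hcont x)).matrix_trace)
  have hi : ∀ x a b, IntervalIntegrable (fun s : ℝ => ((D * Φ s x).trace).re)
    MeasureTheory.volume a b := fun x a b => (hc x).intervalIntegrable a b
  let ω : Mat n →ₗ[ℝ] ℝ :=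
    { toFun := fun x => ∫ s in (0:ℝ)..1, ((D * Φ s x).trace).re
      map_add' := fun x y => by
        rw [← intervalIntegral.integral_add (hi x 0 1) (hi y 0 1)]
        simp [Matrix.mul_add]
      map_smul' := fun c x => by
        simp only [RingHom.id_apply, smul_eq_mul]
        rw [← intervalIntegral.integral_const_mul]
        congr 1; ext s
        have : c • x = (c : ℂ) • x := by ext; simp
        rw [this]; simp }
  have hω : ∀ x, ω x = ∫ s in (0:ℝ)..1, ((D * Φ s x).trace).re := fun _ => rfl
  have hnn : ∀ p : Mat n, p.PosSemidef → ∀ s, 0 ≤ s → 0 ≤ ((D * Φ s p).trace).re := 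
    fun p hp s hs => (qms_trace_nonneg hD (qms_pos (hch s hs) hp)).1
  refine ⟨ω, fun p hp => ?_, fun p hp hz => ?_, fun t ht x => ?_⟩
  · rw [hω]
    exact intervalIntegral.integral_nonneg zero_le_one fun s hs => hnn p hp s hs.1
  · by_contra hne
    have hpos : 0 < ((D * Φ 0 p).trace).re := by
      refine lt_of_le_of_ne (hnn p hp 0 le_rfl) fun h => hne ?_
      rw [h0] at h
      exact (qms_trace_nonneg hD hp).2 h.symm
    have : 0 < ω p := by
      rw [hω]
      exact intervalIntegral.integral_pos one_pos (hc p).continuousOn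
        (fun s hs => hnn p hp s hs.1.le) ⟨0, by simp, hpos⟩
    exact this.ne' hz
  · have e1 : ω (Φ t x) = ∫ s in t..(1 + t), ((D * Φ s x).trace).re := by
      rw [hω]
      have := intervalIntegral.integral_comp_add_right (a := 0) (b := 1)
        (fun s : ℝ => ((D * Φ s x).trace).re) t
      rw [zero_add] at this
      rw [← this]
      refine intervalIntegral.integral_congr fun s hs => ?_
      rw [Set.uIcc_of_le zero_le_one] at hs
      simp only [hadd s t hs.1 ht, LinearMap.comp_apply]
    have e2 : ∫ s in (1:ℝ)..(1 + t), ((D * Φ s x).trace).re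
        = ∫ s in (0:ℝ)..t, ((D * Φ s x).trace).re := by
      have := intervalIntegral.integral_comp_add_left (a := 0) (b := t)
        (fun s : ℝ => ((D * Φ s x).trace).re) 1
      rw [add_zero] at this
      rw [← this]
      refine intervalIntegral.integral_congr fun s hs => ?_
      rw [Set.uIcc_of_le ht] at hs
      simp only [hadd 1 s zero_le_one hs.1, LinearMap.comp_apply, hDi]
    rw [e1, hω]
    have a1 := intervalIntegral.integral_add_adjacent_intervals (hi x 0 t) (hi x t (1 + t))
    have a2 := intervalIntegral.integral_add_adjacent_intervals (hi x 0 1) (hi x 1 (1 + t))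
    linarith

lemma qms_cesaro {f : ℝ → ℂ} (hf : Continuous f) {l m : ℂ} (hl : Tendsto f atTop (nhds l))
    (hm : Tendsto (fun T : ℝ => (T : ℂ)⁻¹ * ∫ s in (0:ℝ)..T, f s) atTop (nhds m)) : l = m := by
  have h1 := hm.comp tendsto_natCast_atTop_atTop
  have ha : Tendsto (fun k : ℕ => ∫ s in (k:ℝ)..((k + 1 : ℕ) : ℝ), f s) atTop (nhds l) := by
    rw [Metric.tendsto_atTop] at hl ⊢
    intro ε hε
    obtain ⟨T, hT⟩ := hl (ε / 2) (by positivity)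
    obtain ⟨N, hN⟩ := exists_nat_ge T
    refine ⟨N, fun k hk => ?_⟩
    have : (∫ s in (k:ℝ)..((k + 1 : ℕ) : ℝ), f s) - l
        = ∫ s in (k:ℝ)..((k + 1 : ℕ) : ℝ), (f s - l) := by
      rw [intervalIntegral.integral_sub (hf.intervalIntegrable _ _)
        (continuous_const.intervalIntegrable _ _)]
      simp
    rw [dist_eq_norm, this]
    have := intervalIntegral.norm_integral_le_of_norm_le_const (a := (k:ℝ))
      (b := ((k + 1 : ℕ) : ℝ)) (f := fun s => f s - l) (C := ε / 2) (fun s hs => by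
        rw [Set.uIoc_of_le (by simp)] at hs
        have hk' : (N : ℝ) ≤ k := by exact_mod_cast hk
        have := hT s (by linarith [hs.1])
        rw [dist_eq_norm] at this
        exact this.le)
    simp at this
    push_cast
    linarith
  refine tendsto_nhds_unique (ha.cesaro_smul) (h1.congr fun N => ?_)
  have := intervalIntegral.sum_integral_adjacent_intervals (f := f)
    (μ := MeasureTheory.volume) (a := fun k : ℕ => (k : ℝ)) (n := N)
    (fun k _ => hf.intervalIntegrable _ _)
  rw [this]
  simp

attribute [local instance] Matrix.normedAddCommGroup Matrix.normedSpace in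
lemma qms_subseq {n : ℕ} (ω : Mat n →ₗ[ℝ] ℝ) (hp : ∀ p : Mat n, p.PosSemidef → 0 ≤ ω p)
    (hf : ∀ p : Mat n, p.PosSemidef → ω p = 0 → p = 0) (u : ℕ → Mat n) (C : ℝ)
    (hu : ∀ k, ω ((u k)ᴴ * u k) ≤ C) :
    ∃ y : Mat n, ∃ φ : ℕ → ℕ, StrictMono φ ∧ Tendsto (fun k => u (φ k)) atTop (nhds y) := by
  have hωc : Continuous ω := ω.continuous_of_finiteDimensional
  have hq : Continuous fun x : Mat n => ω (xᴴ * x) :=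
    hωc.comp (continuous_id.matrix_conjTranspose.matrix_mul continuous_id)
  have hpr : ProperSpace (Mat n) := FiniteDimensional.proper ℝ (Mat n)
  obtain ⟨c, hc, hcq⟩ : ∃ c : ℝ, 0 < c ∧ ∀ x ∈ Metric.sphere (0 : Mat n) 1, c ≤ ω (xᴴ * x) := by
    rcases (Metric.sphere (0 : Mat n) 1).eq_empty_or_nonempty with he | hne
    · exact ⟨1, one_pos, by simp [he]⟩
    · obtain ⟨z, hz, hmin⟩ := (isCompact_sphere (0 : Mat n) 1).exists_isMinOn hne hq.continuousOn
      refine ⟨ω (zᴴ * z), ?_, fun x hx => hmin hx⟩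
      have h1 := hp _ (Matrix.posSemidef_conjTranspose_mul_self z)
      refine lt_of_le_of_ne h1 fun h => ?_
      have := hf _ (Matrix.posSemidef_conjTranspose_mul_self z) h.symm
      rw [Matrix.conjTranspose_mul_self_eq_zero] at this
      simp [this] at hz
  have hco : ∀ x : Mat n, c * ‖x‖ ^ 2 ≤ ω (xᴴ * x) := by
    intro x
    by_cases hx : x = 0
    · simp [hx]
    have hn : 0 < ‖x‖ := norm_pos_iff.mpr hx
    have h1 := hcq (‖x‖⁻¹ • x) (by simp [norm_smul, hn.ne'])
    have h2 : (‖x‖⁻¹ • x)ᴴ * (‖x‖⁻¹ • x) = (‖x‖⁻¹ * ‖x‖⁻¹) • (xᴴ * x) := by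
      rw [Matrix.conjTranspose_smul]; simp [smul_smul]
    rw [h2, map_smul, smul_eq_mul] at h1
    have h3 : c * ‖x‖ ^ 2 ≤ (‖x‖⁻¹ * ‖x‖⁻¹ * ω (xᴴ * x)) * ‖x‖ ^ 2 := by gcongr
    have h4 : (‖x‖⁻¹ * ‖x‖⁻¹ * ω (xᴴ * x)) * ‖x‖ ^ 2 = ω (xᴴ * x) := by field_simp
    linarith
  have hb : ∀ k, u k ∈ Metric.closedBall (0 : Mat n) (Real.sqrt (C / c)) := by
    intro k
    rw [mem_closedBall_zero_iff]
    apply Real.le_sqrt_of_sq_le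
    rw [le_div_iff₀ hc]
    linarith [hco (u k), hu k]
  obtain ⟨y, -, φ, hφ, h⟩ := (isCompact_closedBall (0 : Mat n) _).tendsto_subseq hb
  exact ⟨y, φ, hφ, h⟩

lemma qms_lin_cont {n : ℕ} (F : Mat n →ₗ[ℂ] Mat n) : Continuous F :=
  F.continuous_of_finiteDimensional

/-- a cluster point of an orbit is in the left multiplicative domain -/
lemma qms_cluster {n : ℕ} (Φ : ℝ → (Mat n →ₗ[ℂ] Mat n)) (hΦ : IsQMS n Φ)
    (ω : Mat n →ₗ[ℝ] ℝ) (hf : ∀ p : Mat n, p.PosSemidef → ω p = 0 → p = 0)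
    (hi : ∀ t, 0 ≤ t → ∀ x, ω (Φ t x) = ω x)
    (hle : ∀ t, 0 ≤ t → ∀ x, ω ((Φ t x)ᴴ * Φ t x) ≤ ω (xᴴ * x))
    (hq : Continuous fun x : Mat n => ω (xᴴ * x))
    (x y : Mat n) (φ : ℕ → ℕ) (hφ : StrictMono φ)
    (hy : Tendsto (fun k => Φ (φ k : ℝ) x) atTop (nhds y)) (s : ℝ) (hs : 0 ≤ s) :
    Φ s (yᴴ * y) = (Φ s y)ᴴ * Φ s y := by
  obtain ⟨hch, h0, hadd, hcont⟩ := hΦ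
  have hmono : ∀ a b : ℝ, 0 ≤ a → a ≤ b →
      ω ((Φ b x)ᴴ * Φ b x) ≤ ω ((Φ a x)ᴴ * Φ a x) := by
    intro a b ha hab
    have := hadd (b - a) a (by linarith) ha
    rw [sub_add_cancel] at this
    rw [this]
    exact hle _ (by linarith) _
  have hqy : ∀ r : ℝ, 0 ≤ r → ω (yᴴ * y) ≤ ω ((Φ r x)ᴴ * Φ r x) := by
    intro r hr
    refine le_of_tendsto ((hq.tendsto y).comp hy) ?_
    have : Tendsto (fun k => (φ k : ℝ)) atTop atTop :=
      tendsto_natCast_atTop_atTop.comp hφ.tendsto_atTop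
    filter_upwards [this.eventually_ge_atTop r] with k hk
    exact hmono r _ hr hk
  have h1 : ω (yᴴ * y) ≤ ω ((Φ s y)ᴴ * Φ s y) := by
    have h2 : Tendsto (fun k => Φ s (Φ (φ k : ℝ) x)) atTop (nhds (Φ s y)) :=
      ((qms_lin_cont (Φ s)).tendsto y).comp hy
    refine ge_of_tendsto ((hq.tendsto _).comp h2) (Eventually.of_forall fun k => ?_)
    have := hqy (s + φ k) (by positivity)
    rw [hadd s _ hs (by positivity)] at this
    exact this
  have h3 := hle s hs y
  refine sub_eq_zero.mp (hf _ (qms_schwarz (hch s hs) y).2 ?_)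
  rw [map_sub, hi s hs]
  linarith

/-- **The fixed point space equals the multiplicative domain iff the semigroup converges
to its Cesàro limit.** Here each `Φ_t` is assumed to admit a faithful invariant state, and
`E` is the (entrywise) limit of the Cesàro means `(1/T) ∫_0^T Φ_s ds` as `T → ∞`. -/
theorem fixed_eq_multiplicative_iff_limit {n : ℕ} (Φ : ℝ → (Mat n →ₗ[ℂ] Mat n))
    (hΦ : IsQMS n Φ)
    (hinv : ∀ t : ℝ, 0 ≤ t → ∃ D : Mat n, D.PosDef ∧ D.trace = 1 ∧
      ∀ x : Mat n, (D * Φ t x).trace = (D * x).trace)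
    (E : Mat n →ₗ[ℂ] Mat n)
    (hE : ∀ (x : Mat n) (i j : Fin n),
      Tendsto (fun T : ℝ => (T : ℂ)⁻¹ * ∫ s in (0:ℝ)..T, (Φ s x) i j)
        atTop (nhds ((E x) i j))) :
    ({x : Mat n | ∀ t : ℝ, 0 ≤ t → Φ t x = x} =
      {x : Mat n | ∀ t : ℝ, 0 ≤ t →
        Φ t (xᴴ * x) = (Φ t x)ᴴ * Φ t x ∧ Φ t (x * xᴴ) = Φ t x * (Φ t x)ᴴ}) ↔
    (∀ x : Mat n, Tendsto (fun t : ℝ => Φ t x) atTop (nhds (E x))) := by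
  obtain ⟨ω, hp, hf, hi⟩ := qms_state Φ hΦ hinv
  have hΦ' := hΦ
  obtain ⟨hch, h0, hadd, hcont⟩ := hΦ'
  have hωc : Continuous ω := ω.continuous_of_finiteDimensional
  have hq : Continuous fun x : Mat n => ω (xᴴ * x) :=
    hωc.comp (continuous_id.matrix_conjTranspose.matrix_mul continuous_id)
  have hle : ∀ t, 0 ≤ t → ∀ x, ω ((Φ t x)ᴴ * Φ t x) ≤ ω (xᴴ * x) := by
    intro t ht x
    have := hp _ (qms_schwarz (hch t ht) x).2
    rw [map_sub, hi t ht] at this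
    linarith
  have hstar : ∀ t, 0 ≤ t → ∀ x, Φ t xᴴ = (Φ t x)ᴴ := fun t ht x =>
    (qms_schwarz (hch t ht) x).1
  constructor
  · intro hMN x
    obtain ⟨y, φ, hφ, hy⟩ := qms_subseq ω hp hf (fun k => Φ (k : ℝ) x) (ω (xᴴ * x))
      (fun k => hle _ (by positivity) x)
    have hy' : Tendsto (fun k => Φ (φ k : ℝ) xᴴ) atTop (nhds yᴴ) := by
      have := ((continuous_id.matrix_conjTranspose (R := ℂ)).tendsto y).comp hy
      refine this.congr fun k => ?_
      exact (hstar _ (by positivity) x).symm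
    have hyN : y ∈ {x : Mat n | ∀ t : ℝ, 0 ≤ t → Φ t x = x} := by
      rw [hMN]
      intro t ht
      refine ⟨qms_cluster Φ hΦ ω hf hi hle hq x y φ hφ hy t ht, ?_⟩
      have := qms_cluster Φ hΦ ω hf hi hle hq xᴴ yᴴ φ hφ hy' t ht
      simpa [hstar t ht] using this
    have hfix : ∀ t : ℝ, 0 ≤ t → Φ t y = y := hyN
    -- the distance to `y` tends to zero
    have hlim0 : Tendsto (fun t : ℝ => ω ((Φ t x - y)ᴴ * (Φ t x - y))) atTop (nhds 0) := by
      have hk : Tendsto (fun k => ω ((Φ (φ k : ℝ) x - y)ᴴ * (Φ (φ k : ℝ) x - y))) atTop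
          (nhds 0) := by
        have := (hq.tendsto _).comp (hy.sub_const y)
        simp only [sub_self, Matrix.mul_zero, map_zero] at this
        exact this
      rw [Metric.tendsto_atTop] at hk ⊢
      intro ε hε
      obtain ⟨K, hK⟩ := hk ε hε
      refine ⟨φ K, fun t ht => ?_⟩
      have h1 := hK K le_rfl
      have hφ0 : (0 : ℝ) ≤ φ K := by positivity
      have h2 := hle (t - φ K) (by linarith) (Φ (φ K : ℝ) x - y)
      have h3 := hadd (t - φ K) (φ K) (by linarith) hφ0
      rw [sub_add_cancel] at h3
      rw [map_sub, hfix _ (by linarith), ← LinearMap.comp_apply, ← h3] at h2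
      rw [Real.dist_eq, sub_zero, abs_of_nonneg
        (hp _ (Matrix.posSemidef_conjTranspose_mul_self _))] at h1 ⊢
      linarith
    have hlim : Tendsto (fun t : ℝ => Φ t x) atTop (nhds y) := by
      apply tendsto_of_seq_tendsto
      intro w hw
      apply tendsto_of_subseq_tendsto
      intro ns hns
      have hw' := hw.comp hns
      obtain ⟨N, hN⟩ := (hw'.eventually_ge_atTop 0).exists_forall_of_atTop
      obtain ⟨z, ψ, hψ, hz⟩ := qms_subseq ω hp hf (fun k => Φ (w (ns (k + N))) x) (ω (xᴴ * x))
        (fun k => hle _ (hN _ (by omega)) x)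
      refine ⟨fun k => ψ k + N, ?_⟩
      have hzy : z = y := by
        have a1 : Tendsto (fun k => w (ns (ψ k + N))) atTop atTop :=
          hw'.comp ((tendsto_add_atTop_nat N).comp hψ.tendsto_atTop)
        have a2 := hlim0.comp a1
        have a3 := (hq.tendsto _).comp (hz.sub_const y)
        have a4 := hf _ (Matrix.posSemidef_conjTranspose_mul_self _) (tendsto_nhds_unique a3 a2)
        rw [Matrix.conjTranspose_mul_self_eq_zero] at a4
        exact sub_eq_zero.mp a4
      rw [← hzy]; exact hz
    have hEy : y = E x := by
      ext i j
      refine qms_cesaro (f := fun t => Φ t x i j) ((hcont x).matrix_elem i j) ?_ (hE x i j)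
      exact ((continuous_id.matrix_elem i j).tendsto y).comp hlim
    rw [← hEy]; exact hlim
  · intro hlim
    ext x
    simp only [Set.mem_ofPred_eq]
    constructor
    · have key : ∀ x : Mat n, (∀ t : ℝ, 0 ≤ t → Φ t x = x) → ∀ t : ℝ, 0 ≤ t →
          Φ t (xᴴ * x) = (Φ t x)ᴴ * Φ t x := by
        intro x hx t ht
        refine sub_eq_zero.mp (hf _ (qms_schwarz (hch t ht) x).2 ?_)
        rw [map_sub, hi t ht, hx t ht, sub_self]
      intro hx t ht
      refine ⟨key x hx t ht, ?_⟩
      have := key xᴴ (fun t ht => by rw [hstar t ht, hx t ht]) t ht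
      simpa [hstar t ht] using this
    · intro hx
      have hfix : ∀ t : ℝ, 0 ≤ t → Φ t (E x) = E x := by
        intro t ht
        have h1 : Tendsto (fun s => Φ t (Φ s x)) atTop (nhds (Φ t (E x))) :=
          ((qms_lin_cont (Φ t)).tendsto _).comp (hlim x)
        have h2 : Tendsto (fun s => Φ (t + s) x) atTop (nhds (E x)) :=
          (hlim x).comp (tendsto_atTop_add_const_left _ t tendsto_id)
        refine tendsto_nhds_unique (h1.congr' ?_) h2
        filter_upwards [eventually_ge_atTop 0] with s hs
        rw [hadd t s ht hs]; rfl
      have par : ∀ a b : Mat n, ω ((a + b)ᴴ * (a + b)) + ω ((a - b)ᴴ * (a - b))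
          = 2 * ω (aᴴ * a) + 2 * ω (bᴴ * b) := by
        intro a b
        simp only [Matrix.conjTranspose_add, Matrix.conjTranspose_sub, Matrix.add_mul,
          Matrix.mul_add, Matrix.sub_mul, Matrix.mul_sub, map_add, map_sub]
        ring
      have hiso : ∀ t : ℝ, 0 ≤ t → ω ((x - E x)ᴴ * (x - E x))
          ≤ ω ((Φ t x - E x)ᴴ * (Φ t x - E x)) := by
        intro t ht
        have p1 := par x (E x)
        have p2 := par (Φ t x) (E x)
        have p3 := hle t ht (x + E x)
        rw [map_add, hfix t ht] at p3
        have p4 := hi t ht (xᴴ * x)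
        rw [(hx t ht).1] at p4
        linarith
      have hl0 : Tendsto (fun t => ω ((Φ t x - E x)ᴴ * (Φ t x - E x))) atTop (nhds 0) := by
        have := (hq.tendsto _).comp ((hlim x).sub_const (E x))
        simp only [sub_self, Matrix.mul_zero, map_zero] at this
        exact this
      have hle0 : ω ((x - E x)ᴴ * (x - E x)) ≤ 0 := by
        refine ge_of_tendsto hl0 ?_
        filter_upwards [eventually_ge_atTop 0] with t ht using hiso t ht
      have hpsd := Matrix.posSemidef_conjTranspose_mul_self (x - E x)
      have hz := hf _ hpsd (le_antisymm hle0 (hp _ hpsd))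
      rw [Matrix.conjTranspose_mul_self_eq_zero] at hz
      have hxE : x = E x := sub_eq_zero.mp hz
      intro t ht
      rw [hxE]; exact hfix t ht
end
end

section
/- Let (Φ_t)_{t≥0} be a quantum Markov semigroup on M_n(ℂ), and let D ∈ M_n(ℂ) be positive definite with Tr(D) = 1 such that every Φ_t satisfies the detailed balance condition with respect to the faithful state ρ(x) = Tr(D x): Tr(D Φ_t(y)* x) = Tr(D y* Φ_t(x)) for all x, y and t ≥ 0. Assume the semigroup is relatively ergodic: the only x ∈ M_n(ℂ) with Φ_t(x) = x for all t ≥ 0 are the scalar multiples of the identity. Then for every A ∈ M_n(ℂ), the trace-adjoint satisfies Φ_t†(A) → Tr(A)·D as t → ∞, and equivalently Φ_t(x) → Tr(D x)·1 as t → ∞ for every x ∈ M_n(ℂ). -/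
open Matrix
open scoped ComplexOrder

noncomputable section

open Filter


lemma qms_block (n : ℕ) (x : Mat n) (F : Mat n →ₗ[ℂ] Mat n) (hF : IsQuantumChannel n F) :
    (F (xᴴ * x) - (F x)ᴴ * F x).PosSemidef := by
  obtain ⟨hcp, h1⟩ := hF
  let R : Matrix (Fin n) (Fin 2 × Fin n) ℂ :=
    Matrix.of fun i q => if q.1 = 0 then x i q.2 else (1 : Mat n) i q.2
  have hX : (Rᴴ * R).PosSemidef := Matrix.posSemidef_conjTranspose_mul_self R
  have hM := hcp 2 (by norm_num) _ hX
  set M := blockMap n 2 F (Rᴴ * R) with hMdef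
  have e00 : ∀ i j, M (0, i) (0, j) = F (xᴴ * x) i j := by
    intro i j
    have : (Matrix.of fun i j => (Rᴴ * R) ((0 : Fin 2), i) ((0 : Fin 2), j)) = xᴴ * x := by
      ext a b; simp [R, Matrix.mul_apply]
    simp only [hMdef, blockMap, Matrix.of_apply]; rw [this]
  have e10 : ∀ i j, M (1, i) (0, j) = F x i j := by
    intro i j
    have : (Matrix.of fun i j => (Rᴴ * R) ((1 : Fin 2), i) ((0 : Fin 2), j)) = x := by
      ext a b; simp [R, Matrix.mul_apply, Matrix.one_apply]
    simp only [hMdef, blockMap, Matrix.of_apply]; rw [this]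
  have e11 : ∀ i j, M (1, i) (1, j) = (1 : Mat n) i j := by
    intro i j
    have : (Matrix.of fun i j => (Rᴴ * R) ((1 : Fin 2), i) ((1 : Fin 2), j)) = 1 := by
      ext a b; simp [R, Matrix.mul_apply, Matrix.one_apply, eq_comm]
    simp only [hMdef, blockMap, Matrix.of_apply]; rw [this, h1]
  have e01 : ∀ i j, M (0, i) (1, j) = (F x)ᴴ i j := by
    intro i j
    rw [← hM.isHermitian.apply, e10]; rfl
  let W : Matrix (Fin 2 × Fin n) (Fin n) ℂ :=
    Matrix.of fun p j => if p.1 = 0 then (1 : Mat n) p.2 j else - F x p.2 j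
  have hW := hM.conjTranspose_mul_mul_same W
  have hMW : ∀ p j, (M * W) p j = if p.1 = 0 then (F (xᴴ * x) - (F x)ᴴ * F x) p.2 j else 0 := by
    rintro ⟨a, i⟩ j
    fin_cases a
    · simp [Matrix.mul_apply, Fintype.sum_prod_type, W, e00, e01, Matrix.one_apply, sub_eq_add_neg]
    · simp [Matrix.mul_apply, Fintype.sum_prod_type, W, e10, e11, Matrix.one_apply]
  have : Wᴴ * M * W = F (xᴴ * x) - (F x)ᴴ * F x := by
    ext i j
    rw [Matrix.mul_assoc, Matrix.mul_apply]
    simp only [hMW, Fintype.sum_prod_type]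
    simp [W, Matrix.one_apply]
  rwa [this] at hW

open scoped MatrixOrder Matrix.Norms.L2Operator in
lemma trace_mul_nonneg_aux {n : ℕ} {D P : Mat n} (hD : D.PosSemidef) (hP : P.PosSemidef) :
    0 ≤ (D * P).trace := by
  obtain ⟨B, rfl⟩ := (CStarAlgebra.nonneg_iff_eq_star_mul_self (a := P)).1 hP.nonneg
  rw [← Matrix.mul_assoc, Matrix.trace_mul_comm, ← Matrix.mul_assoc]
  exact (hD.mul_mul_conjTranspose_same B).trace_nonneg

lemma trace_contract {n : ℕ} (F : Mat n →ₗ[ℂ] Mat n) (hF : IsQuantumChannel n F)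
    (D : Mat n) (hD : D.PosDef)
    (hdb : ∀ x y : Mat n, (D * (F y)ᴴ * x).trace = (D * yᴴ * F x).trace) (x : Mat n) :
    (D * (F x)ᴴ * F x).trace ≤ (D * xᴴ * x).trace := by
  have h := trace_mul_nonneg_aux hD.posSemidef (qms_block n x F hF)
  have h2 := hdb (xᴴ * x) 1
  rw [hF.2] at h2
  simp only [Matrix.conjTranspose_one, Matrix.mul_one] at h2
  rw [Matrix.mul_sub, Matrix.trace_sub, ← h2, sub_nonneg] at h
  simpa [Matrix.mul_assoc] using h

lemma quad_conv {n : ℕ} (Φ : ℝ → (Mat n →ₗ[ℂ] Mat n)) (hΦ : IsQMS n Φ)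
    (D : Mat n) (hD : D.PosDef)
    (hdb : ∀ t : ℝ, 0 ≤ t → ∀ x y : Mat n,
      (D * (Φ t y)ᴴ * x).trace = (D * yᴴ * Φ t x).trace) (x : Mat n) :
    ∃ l : ℂ, Tendsto (fun t : ℝ => (D * xᴴ * Φ t x).trace) atTop (nhds l) := by
  obtain ⟨hch, h0, hs, -⟩ := hΦ
  let g : ℝ → ℂ := fun t => (D * (Φ (t / 2) x)ᴴ * Φ (t / 2) x).trace
  have hg : ∀ t, 0 ≤ t → (D * xᴴ * Φ t x).trace = g t := by
    intro t ht
    have h2 : 0 ≤ t / 2 := by positivity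
    simp only [g]
    rw [hdb _ h2, ← LinearMap.comp_apply, ← hs _ _ h2 h2, add_halves]
  have hnn : ∀ t, 0 ≤ g t := by
    intro t
    simp only [g, Matrix.mul_assoc]
    exact trace_mul_nonneg_aux hD.posSemidef (Matrix.posSemidef_conjTranspose_mul_self _)
  have hanti : ∀ s t, 0 ≤ s → s ≤ t → g t ≤ g s := by
    intro s t h1 h2
    have h3 : 0 ≤ (t - s) / 2 := by linarith
    have h4 : 0 ≤ s / 2 := by linarith
    have := trace_contract (Φ ((t - s) / 2)) (hch _ h3) D hD (hdb _ h3) (Φ (s / 2) x)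
    rw [← LinearMap.comp_apply, ← hs _ _ h3 h4, show (t - s) / 2 + s / 2 = t / 2 by ring] at this
    exact this
  have hA : Antitone (fun t : ℝ => (g (max t 0)).re) := by
    intro s t hst
    exact (Complex.le_def.1 (hanti _ _ (le_max_right _ _) (max_le_max_right 0 hst))).1
  have hbd : BddBelow (Set.range (fun t : ℝ => (g (max t 0)).re)) := by
    refine ⟨0, ?_⟩
    rintro _ ⟨t, rfl⟩
    exact (Complex.le_def.1 (hnn _)).1
  have hT := tendsto_atTop_ciInf hA hbd
  refine ⟨_, ((Complex.continuous_ofReal.tendsto _).comp hT).congr' ?_⟩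
  filter_upwards [eventually_ge_atTop 0] with t ht
  simp only [Function.comp_apply, max_eq_left ht]
  rw [hg t ht]
  apply Complex.ext
  · simp
  · simpa using (Complex.le_def.1 (hnn t)).2

lemma sesq_conv {n : ℕ} (Φ : ℝ → (Mat n →ₗ[ℂ] Mat n)) (hΦ : IsQMS n Φ)
    (D : Mat n) (hD : D.PosDef)
    (hdb : ∀ t : ℝ, 0 ≤ t → ∀ x y : Mat n,
      (D * (Φ t y)ᴴ * x).trace = (D * yᴴ * Φ t x).trace) (x y : Mat n) :
    ∃ l : ℂ, Tendsto (fun t : ℝ => (D * yᴴ * Φ t x).trace) atTop (nhds l) := by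
  obtain ⟨a, ha⟩ := quad_conv Φ hΦ D hD hdb (x + y)
  obtain ⟨b, hb⟩ := quad_conv Φ hΦ D hD hdb (x - y)
  obtain ⟨c, hc⟩ := quad_conv Φ hΦ D hD hdb (x + Complex.I • y)
  obtain ⟨d, hd⟩ := quad_conv Φ hΦ D hD hdb (x - Complex.I • y)
  refine ⟨_, (((ha.sub hb).add ((hc.sub hd).const_mul Complex.I)).const_mul (1/4)).congr ?_⟩
  intro t
  simp only [map_add, map_sub, map_smul, Matrix.conjTranspose_add, Matrix.conjTranspose_sub,
    Matrix.conjTranspose_smul, Matrix.mul_add, Matrix.mul_sub, Matrix.add_mul, Matrix.sub_mul,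
    Matrix.trace_add, Matrix.trace_sub, Matrix.mul_smul, Matrix.smul_mul, Matrix.trace_smul,
    smul_eq_mul, Complex.star_def, Complex.conj_I]
  linear_combination (-(1/2) * (D * yᴴ * Φ t x).trace + (1/2) * (D * xᴴ * Φ t y).trace) * Complex.I_mul_I

lemma mat_conv {n : ℕ} (Φ : ℝ → (Mat n →ₗ[ℂ] Mat n)) (hΦ : IsQMS n Φ)
    (D : Mat n) (hD : D.PosDef)
    (hdb : ∀ t : ℝ, 0 ≤ t → ∀ x y : Mat n,
      (D * (Φ t y)ᴴ * x).trace = (D * yᴴ * Φ t x).trace) (x : Mat n) :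
    ∃ L : Mat n, Tendsto (fun t : ℝ => Φ t x) atTop (nhds L) := by
  have key : ∀ i j, ∃ l : ℂ, Tendsto (fun t : ℝ => Φ t x i j) atTop (nhds l) := by
    intro i j
    obtain ⟨l, hl⟩ := sesq_conv Φ hΦ D hD hdb x (D⁻¹ * Matrix.single j i 1)ᴴ
    refine ⟨l, hl.congr fun t => ?_⟩
    have hu : IsUnit D.det := (Matrix.isUnit_iff_isUnit_det _).1 hD.isUnit
    rw [Matrix.conjTranspose_conjTranspose, Matrix.mul_nonsing_inv_cancel_left _ _ hu,
      Matrix.trace_mul_comm, Matrix.trace_mul_single]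
    simp
  choose L hL using key
  exact ⟨L, tendsto_pi_nhds.2 fun i => tendsto_pi_nhds.2 fun j => hL i j⟩

/-- **Convergence of a relatively ergodic detailed-balanced quantum Markov semigroup to
its invariant state.** Here `Ψ t` is the trace-adjoint of `Φ t`. -/
theorem ergodic_convergence {n : ℕ} (Φ : ℝ → (Mat n →ₗ[ℂ] Mat n))
    (hΦ : IsQMS n Φ)
    (D : Mat n) (hD : D.PosDef) (hDtr : D.trace = 1)
    (hdb : ∀ t : ℝ, 0 ≤ t → ∀ x y : Mat n,
      (D * (Φ t y)ᴴ * x).trace = (D * yᴴ * Φ t x).trace)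
    (herg : ∀ x : Mat n, (∀ t : ℝ, 0 ≤ t → Φ t x = x) → ∃ c : ℂ, x = c • (1 : Mat n))
    (Ψ : ℝ → (Mat n →ₗ[ℂ] Mat n))
    (hΨ : ∀ t : ℝ, 0 ≤ t → ∀ x y : Mat n,
      ((Ψ t y)ᴴ * x).trace = (yᴴ * Φ t x).trace) :
    (∀ A : Mat n, Tendsto (fun t : ℝ => Ψ t A) atTop (nhds (A.trace • D))) ∧
    (∀ x : Mat n, Tendsto (fun t : ℝ => Φ t x)
      atTop (nhds ((D * x).trace • (1 : Mat n)))) := by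
  have hPhi : ∀ x : Mat n, Tendsto (fun t : ℝ => Φ t x)
      atTop (nhds ((D * x).trace • (1 : Mat n))) := by
    intro x
    obtain ⟨L, hL⟩ := mat_conv Φ hΦ D hD hdb x
    have hfix : ∀ s : ℝ, 0 ≤ s → Φ s L = L := by
      intro s hs
      have hc : Continuous (Φ s) := LinearMap.continuous_of_finiteDimensional _
      have h1 := (hc.tendsto L).comp hL
      have h2 : Tendsto (fun t : ℝ => Φ (s + t) x) atTop (nhds L) :=
        hL.comp (tendsto_atTop_add_const_left _ s tendsto_id)
      refine tendsto_nhds_unique h1 (h2.congr' ?_)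
      filter_upwards [eventually_ge_atTop 0] with t ht
      rw [hΦ.2.2.1 s t hs ht]; rfl
    obtain ⟨c, hc⟩ := herg L hfix
    have hcont : Continuous fun z : Mat n => (D * z).trace := by fun_prop
    have h1 := (hcont.tendsto L).comp hL
    have h2 : Tendsto (fun _ : ℝ => (D * x).trace) atTop (nhds (D * L).trace) := by
      refine h1.congr' ?_
      filter_upwards [eventually_ge_atTop 0] with t ht
      have := hdb t ht x 1
      rw [(hΦ.1 t ht).2] at this
      simpa using this.symm
    have h3 := tendsto_nhds_unique h2 tendsto_const_nhds
    have h4 : (D * x).trace = c := by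
      rw [← h3, hc]; simp [hDtr]
    rw [h4, ← hc]; exact hL
  refine ⟨fun A => ?_, hPhi⟩
  refine tendsto_pi_nhds.2 fun i => tendsto_pi_nhds.2 fun j => ?_
  have hcont : Continuous fun z : Mat n => star ((Aᴴ * z).trace) := by fun_prop
  have h1 := (hcont.tendsto _).comp (hPhi (Matrix.single i j 1))
  have h2 : star ((Aᴴ * ((D * Matrix.single i j 1).trace • (1 : Mat n))).trace)
      = (A.trace • D) i j := by
    rw [Matrix.trace_mul_single]
    simp only [Matrix.mul_smul, Matrix.mul_one, Matrix.trace_smul, Matrix.trace_conjTranspose]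
    simp only [smul_eq_mul, star_mul', star_star, Matrix.smul_apply, mul_one, hD.1.apply]
    simp [hD.1.apply, mul_comm]
  rw [h2] at h1
  refine h1.congr' ?_
  filter_upwards [eventually_ge_atTop 0] with t ht
  simp only [Function.comp_apply]
  rw [← hΨ t ht, Matrix.trace_mul_single]
  simp
end
end
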